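/- Let (J₁, J₂) be a linear generalized Kähler structure on 𝕍 = V × V* with G = −J₁∘J₂, let K ⊆ V* be a subspace satisfying (1) K + J₁(K) ⊆ Ann(K + J₁(K)) and (2) J₁(K) ∩ V* = {0}, and set W_K = Ann(K + J₁(K) + J₂(K) + G(K)) and N = a(J₁(K)). Then N ⊆ Ann_V(K), the projection a maps W_K into Ann_V(K), and the induced linear map a_K : W_K → Ann_V(K)/N is surjective. (Surjection part of the self-dual exact sequence of Lemma kahler:sequence.) -/

import Mathlib

/-- The generalized tangent space `𝕍 = V × V*`. -/
abbrev GV (V : Type*) [AddCommGroup V] [Module ℝ V] := V × Module.Dual ℝ V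

variable (V : Type*) [AddCommGroup V] [Module ℝ V] [FiniteDimensional ℝ V]

/-- The canonical symmetric pairing `⟨(X,ξ),(Y,η)⟩ = (1/2)(η X + ξ Y)` on `𝕍`. -/
noncomputable def pairForm : LinearMap.BilinForm ℝ (GV V) :=
  LinearMap.mk₂ ℝ (fun u v => (1 / 2 : ℝ) * (v.2 u.1 + u.2 v.1))
    (fun u u' v => by simp; ring)
    (fun c u v => by simp; ring)
    (fun u v v' => by simp; ring)
    (fun c u v => by simp; ring)

/-- `V* = {0} × V*` as a subspace of `𝕍`. -/
def VStar : Submodule ℝ (GV V) := LinearMap.range (LinearMap.inr ℝ V (Module.Dual ℝ V))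

variable {V}

/-- The annihilator of a subspace of `𝕍` with respect to the canonical pairing. -/
noncomputable def Ann (S : Submodule ℝ (GV V)) : Submodule ℝ (GV V) where
  carrier := {u : GV V | ∀ s ∈ S, pairForm V u s = 0}
  add_mem' := fun ha hb s hs => by simp [ha s hs, hb s hs]
  zero_mem' := fun s hs => by simp
  smul_mem' := fun c a ha s hs => by simp [ha s hs]

/-- The image in `𝕍` of a subspace `K ⊆ V*`. -/
def ofDual (K : Submodule ℝ (Module.Dual ℝ V)) : Submodule ℝ (GV V) :=
  K.map (LinearMap.inr ℝ V (Module.Dual ℝ V))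

/-- A linear generalized complex structure on `𝕍`. -/
structure IsGenCx (J : GV V →ₗ[ℝ] GV V) : Prop where
  sq : ∀ u, J (J u) = -u
  orth : ∀ u v, pairForm V (J u) (J v) = pairForm V u v

/-- A linear generalized Kähler structure on `𝕍`: two commuting linear generalized
complex structures such that `G = -J₁∘J₂` gives a positive definite form `⟨G·,·⟩`. -/
structure IsGenKahler (J₁ J₂ : GV V →ₗ[ℝ] GV V) : Prop where
  cx1 : IsGenCx J₁
  cx2 : IsGenCx J₂
  comm : ∀ u, J₁ (J₂ u) = J₂ (J₁ u)
  posdef : ∀ u : GV V, u ≠ 0 → 0 < pairForm V (-(J₁ (J₂ u))) u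

theorem pairForm_apply {V : Type*} [AddCommGroup V] [Module ℝ V] [FiniteDimensional ℝ V]
    (u v : GV V) : pairForm V u v = (1 / 2 : ℝ) * (v.2 u.1 + u.2 v.1) := rfl

theorem pairForm_comm {V : Type*} [AddCommGroup V] [Module ℝ V] [FiniteDimensional ℝ V]
    (u v : GV V) : pairForm V u v = pairForm V v u := by
  simp only [pairForm_apply]
  ring

theorem mem_dualCoannihilator_of_pairForm {V : Type*} [AddCommGroup V] [Module ℝ V]
    [FiniteDimensional ℝ V] {K : Submodule ℝ (Module.Dual ℝ V)} {u : GV V}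
    (hu : ∀ k ∈ K, pairForm V u (0, k) = 0) : u.1 ∈ K.dualCoannihilator := by
  rw [Submodule.mem_dualCoannihilator]
  intro k hk
  simpa [pairForm_apply] using hu k hk

/-- A prescribed functional on `K` is realised through an injective map `K → V`. -/
theorem exists_dual_comp_eq {K V : Type*} [AddCommGroup K] [Module ℝ K] [AddCommGroup V]
    [Module ℝ V] (f : K →ₗ[ℝ] V) (hf : Function.Injective f) (φ : Module.Dual ℝ K) :
    ∃ ξ : Module.Dual ℝ V, ∀ k, ξ (f k) = φ k := by
  obtain ⟨g, hg⟩ := f.exists_leftInverse_of_injective (LinearMap.ker_eq_bot.2 hf)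
  exact ⟨φ ∘ₗ g, fun k => congrArg φ (LinearMap.congr_fun hg k)⟩

/-- A bilinear form that is anisotropic on a finite-dimensional subspace `E` represents every
functional on `E`. -/
theorem exists_mem_forall_eq_of_anisotropic {M : Type*} [AddCommGroup M] [Module ℝ M]
    (B : LinearMap.BilinForm ℝ M) (E : Submodule ℝ M) [FiniteDimensional ℝ E]
    (hB : ∀ e ∈ E, B e e = 0 → e = 0) (u : M) : ∃ e ∈ E, ∀ e' ∈ E, B e e' = B u e' := by
  let T : E →ₗ[ℝ] Module.Dual ℝ E := B.domRestrict₁₂ E E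
  have hT : Function.Injective T := by
    rw [← LinearMap.ker_eq_bot, LinearMap.ker_eq_bot']
    intro e he
    exact Subtype.ext (hB e e.2 (LinearMap.congr_fun he e))
  have hT' : Function.Surjective T :=
    (LinearMap.injective_iff_surjective_of_finrank_eq_finrank
      (Subspace.dual_finrank_eq (K := ℝ) (V := E)).symm).1 hT
  obtain ⟨e, he⟩ := hT' ((B u).domRestrict E)
  exact ⟨e, e.2, fun e' he' => LinearMap.congr_fun he ⟨e', he'⟩⟩

/-- surjection part of the self-dual exact sequence of Lemma
kahler:sequence: with `N = a(J₁(K))`, one has `N ⊆ Ann_V(K)`, the projection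
`a` maps `W_K` into `Ann_V(K)`, and the induced map `a_K : W_K → Ann_V(K)/N`
is surjective. -/
theorem statement8 {V : Type*} [AddCommGroup V] [Module ℝ V] [FiniteDimensional ℝ V]
    (J₁ J₂ : GV V →ₗ[ℝ] GV V) (h : IsGenKahler J₁ J₂)
    (K : Submodule ℝ (Module.Dual ℝ V))
    (hK : ofDual K ⊔ (ofDual K).map J₁ ≤ Ann (ofDual K ⊔ (ofDual K).map J₁))
    (hV : (ofDual K).map J₁ ⊓ VStar V = ⊥) :
    let G : GV V →ₗ[ℝ] GV V := -(J₁ ∘ₗ J₂)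
    let Kv : Submodule ℝ (GV V) := ofDual K
    let W : Submodule ℝ (GV V) := Ann (Kv ⊔ Kv.map J₁ ⊔ Kv.map J₂ ⊔ Kv.map G)
    let N : Submodule ℝ V := (Kv.map J₁).map (LinearMap.fst ℝ V (Module.Dual ℝ V))
    N ≤ K.dualCoannihilator ∧
    (∀ x ∈ W, (x : GV V).1 ∈ K.dualCoannihilator) ∧
    (∀ X ∈ K.dualCoannihilator, ∃ w ∈ W, (w : GV V).1 - X ∈ N) := by
  intro G Kv W N
  set E : Submodule ℝ (GV V) := ofDual K ⊔ (ofDual K).map J₁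
  have memK : ∀ k ∈ K, ((0, k) : GV V) ∈ Kv := fun k hk => ⟨k, hk, rfl⟩
  have hKE : Kv ≤ E := le_sup_left
  have hJE : Kv.map J₁ ≤ E := le_sup_right
  have hiso : ∀ u ∈ E, ∀ v ∈ E, pairForm V u v = 0 := fun u hu v hv => hK hu v hv
  refine ⟨?_, ?_, ?_⟩
  · rintro _ ⟨u, hu, rfl⟩
    exact mem_dualCoannihilator_of_pairForm
      fun k hk => hiso u (hJE hu) _ (hKE (memK k hk))
  · intro x hx
    exact mem_dualCoannihilator_of_pairForm fun k hk => hx _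
      (Submodule.mem_sup_left (Submodule.mem_sup_left (Submodule.mem_sup_left (memK k hk))))
  · intro X hX
    rw [Submodule.mem_dualCoannihilator] at hX
    let j : K →ₗ[ℝ] GV V := J₁ ∘ₗ LinearMap.inr ℝ V (Module.Dual ℝ V) ∘ₗ K.subtype
    have hJinj : Function.Injective (LinearMap.fst ℝ V (Module.Dual ℝ V) ∘ₗ j) := by
      refine (injective_iff_map_eq_zero _).2 fun k hk => ?_
      have hmem : j k ∈ (ofDual K).map J₁ ⊓ VStar V :=
        ⟨⟨_, memK k k.2, rfl⟩, (j k).2, Prod.ext hk.symm rfl⟩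
      rw [hV, Submodule.mem_bot] at hmem
      have h0 : ((0, (k : Module.Dual ℝ V)) : GV V) = 0 := by
        rw [← neg_eq_zero, ← h.cx1.sq]
        exact (congrArg J₁ hmem).trans (map_zero J₁)
      exact Subtype.ext (congrArg Prod.snd h0)
    obtain ⟨ξ, hξ⟩ := exists_dual_comp_eq (K := K) _ hJinj
      (-(Module.Dual.eval ℝ V X ∘ₗ LinearMap.snd ℝ V (Module.Dual ℝ V) ∘ₗ j))
    have huE : ∀ e ∈ E, pairForm V (X, ξ) e = 0 := by
      have : E ≤ LinearMap.ker (pairForm V (X, ξ)) := by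
        refine sup_le ?_ ?_
        · rintro _ ⟨k, hk, rfl⟩
          simp [pairForm_apply, hX k hk]
        · rintro _ ⟨_, ⟨k, hk, rfl⟩, rfl⟩
          have hk' : ξ (j ⟨k, hk⟩).1 = -(j ⟨k, hk⟩).2 X := hξ ⟨k, hk⟩
          change pairForm V (X, ξ) (j ⟨k, hk⟩) = 0
          simp [pairForm_apply, hk']
      exact this
    obtain ⟨e, heE, he⟩ := exists_mem_forall_eq_of_anisotropic
      ((pairForm V).compl₂ G) E (fun e _ h0 => by
        by_contra hne
        have hpos := h.posdef e hne
        rw [pairForm_comm] at hpos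
        exact hpos.ne' h0) (X, ξ)
    have hwE : E ≤ LinearMap.ker (pairForm V ((X, ξ) - e)) := fun v hv => by
      simp [huE v hv, hiso e heE v hv]
    have hwG : ∀ v ∈ E, pairForm V ((X, ξ) - e) (G v) = 0 := fun v hv => by
      rw [map_sub, LinearMap.sub_apply, sub_eq_zero]
      exact (he v hv).symm
    refine ⟨(X, ξ) - e, ?_, ?_⟩
    · change Kv ⊔ Kv.map J₁ ⊔ Kv.map J₂ ⊔ Kv.map G ≤ LinearMap.ker (pairForm V ((X, ξ) - e))
      refine sup_le (sup_le hwE ?_) ?_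
      · rintro _ ⟨k, hk, rfl⟩
        have hGJ : G (J₁ k) = J₂ k := by
          simp [G, ← h.comm, h.cx1.sq]
        rw [LinearMap.mem_ker, ← hGJ]
        exact hwG _ (hJE ⟨k, hk, rfl⟩)
      · rintro _ ⟨k, hk, rfl⟩
        exact hwG k (hKE hk)
    · obtain ⟨_, ⟨k, hk, rfl⟩, v, hv, rfl⟩ := Submodule.mem_sup.1 heE
      have : (((X, ξ) - (LinearMap.inr ℝ V (Module.Dual ℝ V) k + v) : GV V)).1 - X = -v.1 := by
        simp
      rw [this]
      exact N.neg_mem ⟨v, hv, rfl⟩
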